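/- Let N be an even power of 2, m = N·log₂N, and let f : {-1,1}^m → {-1,1} be the 2-to-1 function. Then for every ε > 0, odeg_ε(f) ≥ deg̃_ε(f)/log₂m. -/

import Mathlib

open Finset

noncomputable section

/-- The real value of a Boolean bit: `true` encodes `-1` (logical TRUE), `false` encodes `1`. -/
def bval (b : Bool) : ℝ := if b then -1 else 1

/-- The parity character `χ_S(x) = ∏_{i ∈ S} x_i`. -/
def chi {ι : Type*} (S : Finset ι) (x : ι → Bool) : ℝ := ∏ i ∈ S, bval (x i)

/-- The multilinear polynomial with coefficient family `c`. -/
def polyOf {ι : Type*} [Fintype ι] (c : Finset ι → ℝ) (x : ι → Bool) : ℝ :=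
  ∑ S : Finset ι, c S * chi S x

/-- The coefficient family `c` has degree at most `d`. -/
def degLE {ι : Type*} (c : Finset ι → ℝ) (d : ℕ) : Prop :=
  ∀ S : Finset ι, d < S.card → c S = 0

/-- `p` is a pointwise `ε`-approximation to the Boolean function `f`. -/
def IsApprox {ι : Type*} (f : (ι → Bool) → Bool) (p : (ι → Bool) → ℝ) (ε : ℝ) : Prop :=
  ∀ x, |p x - bval (f x)| ≤ ε

/-- `p` is an `ε`-one-sided approximation to the Boolean function `f`. -/
def IsOneSided {ι : Type*} (f : (ι → Bool) → Bool) (p : (ι → Bool) → ℝ) (ε : ℝ) : Prop :=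
  (∀ x, f x = false → |p x - 1| ≤ ε) ∧ (∀ x, f x = true → p x ≤ -1 + ε)

/-- The `ε`-approximate degree `deg̃_ε(f)`. -/
def adeg {ι : Type*} [Fintype ι] (ε : ℝ) (f : (ι → Bool) → Bool) : ℕ :=
  sInf {d | ∃ c : Finset ι → ℝ, degLE c d ∧ IsApprox f (polyOf c) ε}

/-- The one-sided `ε`-approximate degree `odeg_ε(f)`. -/
def odeg {ι : Type*} [Fintype ι] (ε : ℝ) (f : (ι → Bool) → Bool) : ℕ :=
  sInf {d | ∃ c : Finset ι → ℝ, degLE c d ∧ IsOneSided f (polyOf c) ε}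

/-- Read an input `x ∈ {-1,1}^{N·k}` (indexed as `N` blocks of `k` bits) as a function
`g_x : [N] → [2^k]`, each block giving the binary representation of its value. -/
def gOf {N k : ℕ} (x : Fin N × Fin k → Bool) (i : Fin N) : Fin (2 ^ k) :=
  finFunctionFinEquiv (fun j => if x (i, j) then 1 else 0)


/-- The 2-to-1 function on `N = 2^k` blocks of `k` bits: it is TRUE (`true`, i.e. `-1`)
iff every value taken by `g_x` is taken exactly twice (equivalently, exactly `N/2`
distinct values occur, each with multiplicity exactly 2). -/
def twoToOne (k : ℕ) (x : Fin (2 ^ k) × Fin k → Bool) : Bool :=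
  decide (∀ i : Fin (2 ^ k),
    (Finset.univ.filter (fun i' => gOf x i' = gOf x i)).card = 2)

/-- `p` is representable by a polynomial of degree at most `d`. -/
def HasDeg {ι : Type*} [Fintype ι] (d : ℕ) (p : (ι → Bool) → ℝ) : Prop :=
  ∃ c : Finset ι → ℝ, degLE c d ∧ ∀ x, polyOf c x = p x

lemma HasDeg.add {ι : Type*} [Fintype ι] {d : ℕ} {p q : (ι → Bool) → ℝ}
    (hp : HasDeg d p) (hq : HasDeg d q) : HasDeg d (fun x => p x + q x) := by
  obtain ⟨c, hc, hcp⟩ := hp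
  obtain ⟨e, he, heq⟩ := hq
  refine ⟨fun S => c S + e S, fun S hS => by simp [hc S hS, he S hS], fun x => ?_⟩
  beta_reduce
  rw [← hcp, ← heq]
  simp [polyOf, add_mul, Finset.sum_add_distrib]

lemma HasDeg.smul {ι : Type*} [Fintype ι] {d : ℕ} {p : (ι → Bool) → ℝ}
    (hp : HasDeg d p) (a : ℝ) : HasDeg d (fun x => a * p x) := by
  obtain ⟨c, hc, hcp⟩ := hp
  refine ⟨fun S => a * c S, fun S hS => by simp [hc S hS], fun x => ?_⟩
  beta_reduce
  rw [← hcp]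
  simp [polyOf, mul_assoc, Finset.mul_sum]

lemma HasDeg.zero {ι : Type*} [Fintype ι] (d : ℕ) :
    HasDeg (ι := ι) d (fun _ => 0) :=
  ⟨fun _ => 0, fun _ _ => rfl, fun x => by simp [polyOf]⟩

lemma HasDeg.sum {ι : Type*} [Fintype ι] {d : ℕ} {α : Type*} (s : Finset α)
    (p : α → (ι → Bool) → ℝ) (h : ∀ a ∈ s, HasDeg d (p a)) :
    HasDeg d (fun x => ∑ a ∈ s, p a x) := by
  classical
  induction s using Finset.induction_on with
  | empty => simpa using HasDeg.zero d
  | insert a s ha ih =>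
    simp only [Finset.sum_insert ha]
    exact (h a (by simp)).add (ih (fun b hb => h b (by simp [hb])))

lemma HasDeg.chi {ι : Type*} [Fintype ι] {d : ℕ} (S : Finset ι) (hS : S.card ≤ d) :
    HasDeg d (chi S) := by
  classical
  refine ⟨fun T => if T = S then 1 else 0, fun T hT => ?_, fun x => ?_⟩
  · beta_reduce
    rw [if_neg]
    rintro rfl
    omega
  · simp [polyOf]

lemma HasDeg.const {ι : Type*} [Fintype ι] (d : ℕ) (a : ℝ) :
    HasDeg (ι := ι) d (fun _ => a) := by
  have := (HasDeg.chi (ι := ι) (d := d) ∅ (by simp)).smul a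
  simpa [_root_.chi] using this

lemma bval_ind (a b : Bool) : (1 + bval a * bval b) / 2 = if a = b then 1 else 0 := by
  cases a <;> cases b <;> simp [bval]

lemma prod_ind {ι : Type*} [Fintype ι] (T : Finset ι) (x y : ι → Bool) :
    ∏ i ∈ T, ((1 + bval (y i) * bval (x i)) / 2) = if ∀ i ∈ T, y i = x i then 1 else 0 := by
  classical
  simp only [bval_ind]
  split_ifs with h
  · exact Finset.prod_eq_one (fun i hi => by simp [h i hi])
  · push Not at h
    obtain ⟨i, hi, hne⟩ := h
    exact Finset.prod_eq_zero hi (by simp [hne])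

lemma hasDeg_prod {ι : Type*} [Fintype ι] (T : Finset ι) (y : ι → Bool) :
    HasDeg T.card (fun x => ∏ i ∈ T, ((1 + bval (y i) * bval (x i)) / 2)) := by
  classical
  have : (fun x : ι → Bool => ∏ i ∈ T, ((1 + bval (y i) * bval (x i)) / 2)) =
      fun x => ∑ S ∈ T.powerset, ((1 / 2 : ℝ) ^ T.card * chi S y) * chi S x := by
    funext x
    rw [Finset.prod_div_distrib, Finset.prod_one_add, Finset.prod_const, Finset.sum_div]
    refine Finset.sum_congr rfl fun S _ => ?_
    rw [Finset.prod_mul_distrib]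
    simp only [chi, one_div, inv_pow]
    ring
  rw [this]
  refine HasDeg.sum _ _ fun S hS => HasDeg.smul (HasDeg.chi S ?_) _
  exact Finset.card_le_card (Finset.mem_powerset.1 hS)

lemma hasDeg_junta {ι : Type*} [Fintype ι] (T : Finset ι) (h : (ι → Bool) → ℝ)
    (hT : ∀ x y, (∀ i ∈ T, x i = y i) → h x = h y) : HasDeg T.card h := by
  classical
  have key : h = fun x => ∑ y ∈ Finset.univ.filter (fun y : ι → Bool => ∀ i, i ∉ T → y i = false),
      h y * ∏ i ∈ T, ((1 + bval (y i) * bval (x i)) / 2) := by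
    funext x
    rw [Finset.sum_eq_single (fun i => if i ∈ T then x i else false)]
    · rw [prod_ind, if_pos (fun i hi => by simp [hi]), mul_one]
      exact hT _ _ (fun i hi => by simp [hi])
    · intro y hy hne
      rw [prod_ind, if_neg, mul_zero]
      intro hall
      apply hne
      funext i
      by_cases hi : i ∈ T
      · simp [hi, hall i hi]
      · simp [hi, (Finset.mem_filter.1 hy).2 i hi]
    · intro hn
      exact absurd (Finset.mem_filter.2 ⟨Finset.mem_univ _, fun i hi => by simp [hi]⟩) hn
  rw [key]
  exact HasDeg.sum _ _ fun y _ => (hasDeg_prod T y).smul _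

lemma HasDeg.mono {ι : Type*} [Fintype ι] {d e : ℕ} {p : (ι → Bool) → ℝ}
    (hp : HasDeg d p) (h : d ≤ e) : HasDeg e p := by
  obtain ⟨c, hc, hcp⟩ := hp
  exact ⟨c, fun S hS => hc S (by omega), hcp⟩

/-- Act on inputs by a permutation of the range and a permutation of the blocks. -/
def act {N k : ℕ} (g : Equiv.Perm (Fin k → Bool) × Equiv.Perm (Fin N))
    (x : Fin N × Fin k → Bool) : Fin N × Fin k → Bool :=
  fun ij => g.1 (fun j => x (g.2 ij.1, j)) ij.2

lemma hasDeg_chi_act {N k : ℕ} (g : Equiv.Perm (Fin k → Bool) × Equiv.Perm (Fin N))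
    (S : Finset (Fin N × Fin k)) :
    HasDeg (S.card * k) (fun x => chi S (act g x)) := by
  classical
  refine (hasDeg_junta ((S.image (fun ij => g.2 ij.1)) ×ˢ (Finset.univ : Finset (Fin k)))
    _ ?_).mono ?_
  · intro x y hxy
    refine Finset.prod_congr rfl fun ij hij => ?_
    have : (fun j => x (g.2 ij.1, j)) = fun j => y (g.2 ij.1, j) := by
      funext j
      exact hxy _ (Finset.mem_product.2 ⟨Finset.mem_image_of_mem _ hij, Finset.mem_univ _⟩)
    simp only [act, this]
  · rw [Finset.card_product, Finset.card_univ, Fintype.card_fin]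
    exact Nat.mul_le_mul_right _ Finset.card_image_le

lemma hasDeg_act {N k d : ℕ} (g : Equiv.Perm (Fin k → Bool) × Equiv.Perm (Fin N))
    (c : Finset (Fin N × Fin k) → ℝ) (hc : degLE c d) :
    HasDeg (d * k) (fun x => polyOf c (act g x)) := by
  unfold polyOf
  refine HasDeg.sum _ _ fun S _ => ?_
  by_cases hS : d < S.card
  · simpa [hc S hS] using HasDeg.zero _
  · exact ((hasDeg_chi_act g S).mono (Nat.mul_le_mul_right _ (by omega))).smul _

lemma gOf_eq_iff {N k : ℕ} (x : Fin N × Fin k → Bool) (i i' : Fin N) :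
    gOf x i' = gOf x i ↔ (fun j => x (i', j)) = fun j => x (i, j) := by
  unfold gOf
  rw [finFunctionFinEquiv.apply_eq_iff_eq]
  constructor
  · intro h
    funext j
    have := congrFun h j
    cases h1 : x (i', j) <;> cases h2 : x (i, j) <;> simp [h1, h2] at this ⊢
  · intro h
    funext j
    have := congrFun h j
    rw [this]

lemma twoToOne_iff (k : ℕ) (x : Fin (2 ^ k) × Fin k → Bool) :
    twoToOne k x = true ↔ ∀ i : Fin (2 ^ k),
      (Finset.univ.filter (fun i' => (fun j => x (i', j)) = fun j => x (i, j))).card = 2 := by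
  simp only [twoToOne, gOf_eq_iff, decide_eq_true_eq]

lemma act_block {N k : ℕ} (g : Equiv.Perm (Fin k → Bool) × Equiv.Perm (Fin N))
    (x : Fin N × Fin k → Bool) (i : Fin N) :
    (fun j => act g x (i, j)) = g.1 (fun j => x (g.2 i, j)) := rfl

lemma twoToOne_act (k : ℕ) (g : Equiv.Perm (Fin k → Bool) × Equiv.Perm (Fin (2 ^ k)))
    (x : Fin (2 ^ k) × Fin k → Bool) : twoToOne k (act g x) = twoToOne k x := by
  rw [Bool.eq_iff_iff, twoToOne_iff, twoToOne_iff]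
  simp only [act_block, g.1.apply_eq_iff_eq]
  have hcard : ∀ i, (Finset.univ.filter
      (fun i' => (fun j => x (g.2 i', j)) = fun j => x (g.2 i, j))).card =
      (Finset.univ.filter (fun i' => (fun j => x (i', j)) = fun j => x (g.2 i, j))).card := by
    intro i
    refine Finset.card_bij (fun a _ => g.2 a) ?_ ?_ ?_
    · intro a ha
      simpa using ha
    · intro a _ b _ h
      exact g.2.injective h
    · intro b hb
      exact ⟨g.2.symm b, by simpa using hb, by simp⟩
  simp only [hcard]
  exact ⟨fun h i => by simpa using h (g.2.symm i), fun h i => h (g.2 i)⟩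

lemma card_image_two {α V : Type*} [Fintype α] [DecidableEq V] (b : α → V)
    (hb : ∀ i, (Finset.univ.filter (fun i' => b i' = b i)).card = 2) :
    Fintype.card α = 2 * (Finset.univ.image b).card := by
  rw [← Finset.card_univ, Finset.card_eq_sum_card_image b, Finset.sum_const_nat (m := 2), mul_comm]
  intro v hv
  obtain ⟨i, _, rfl⟩ := Finset.mem_image.1 hv
  exact hb i

lemma transitive_two {α V : Type*} [Fintype α] [Fintype V] [DecidableEq V] (b b' : α → V)
    (hb : ∀ i, (Finset.univ.filter (fun i' => b i' = b i)).card = 2)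
    (hb' : ∀ i, (Finset.univ.filter (fun i' => b' i' = b' i)).card = 2) :
    ∃ (π : Equiv.Perm V) (σ : Equiv.Perm α), ∀ i, π (b (σ i)) = b' i := by
  classical
  have h1 := card_image_two b hb
  have h2 := card_image_two b' hb'
  have h3 : (Finset.univ.image b).card = (Finset.univ.image b').card := by omega
  let e : {v // v ∈ Finset.univ.image b} ≃ {v // v ∈ Finset.univ.image b'} :=
    Finset.equivOfCardEq h3
  let π : Equiv.Perm V := e.extendSubtype
  have hπ : ∀ v, π v ∈ Finset.univ.image b' ↔ v ∈ Finset.univ.image b := by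
    intro v
    constructor
    · intro h
      by_contra hn
      exact e.extendSubtype_not_mem v hn h
    · exact fun h => e.extendSubtype_mem v h
  have hfib : ∀ v, Nonempty ({i // b' i = v} ≃ {i // π (b i) = v}) := by
    intro v
    rw [← Fintype.card_eq, Fintype.card_subtype, Fintype.card_subtype]
    obtain ⟨w, rfl⟩ := π.surjective v
    simp only [π.apply_eq_iff_eq]
    by_cases hw : w ∈ Finset.univ.image b
    · have hw' := (hπ w).2 hw
      obtain ⟨i, _, hi⟩ := Finset.mem_image.1 hw
      obtain ⟨i', _, hi'⟩ := Finset.mem_image.1 hw'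
      rw [← hi', hb', ← hi, hb]
    · have hw' := (not_congr (hπ w)).2 hw
      rw [Finset.card_eq_zero.2, Finset.card_eq_zero.2]
      · ext i
        simp only [Finset.mem_filter, Finset.mem_univ, true_and, Finset.notMem_empty, iff_false]
        exact fun h => hw (Finset.mem_image.2 ⟨i, Finset.mem_univ _, h⟩)
      · ext i
        simp only [Finset.mem_filter, Finset.mem_univ, true_and, Finset.notMem_empty, iff_false]
        exact fun h => hw' (Finset.mem_image.2 ⟨i, Finset.mem_univ _, h⟩)
  let σ : Equiv.Perm α := (Equiv.sigmaFiberEquiv b').symm.trans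
    ((Equiv.sigmaCongrRight (fun v => (hfib v).some)).trans
      (Equiv.sigmaFiberEquiv (fun i => π (b i))))
  exact ⟨π, σ, fun i => ((hfib (b' i)).some ⟨i, rfl⟩).2⟩

lemma act_transitive (k : ℕ) (x y : Fin (2 ^ k) × Fin k → Bool)
    (hx : twoToOne k x = true) (hy : twoToOne k y = true) : ∃ g, act g x = y := by
  rw [twoToOne_iff] at hx hy
  obtain ⟨π, σ, h⟩ := transitive_two (fun i j => x (i, j)) (fun i j => y (i, j))
    (by convert hx) (by convert hy)
  refine ⟨(π, σ), ?_⟩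
  funext ⟨i, j⟩
  exact congrFun (h i) j

/-- Symmetrization. -/
def symz {N k : ℕ} (p : (Fin N × Fin k → Bool) → ℝ) (x : Fin N × Fin k → Bool) : ℝ :=
  ((Fintype.card (Equiv.Perm (Fin k → Bool) × Equiv.Perm (Fin N)) : ℝ))⁻¹ *
    ∑ g : Equiv.Perm (Fin k → Bool) × Equiv.Perm (Fin N), p (act g x)

lemma symz_act {N k : ℕ} (p : (Fin N × Fin k → Bool) → ℝ)
    (g : Equiv.Perm (Fin k → Bool) × Equiv.Perm (Fin N)) (x : Fin N × Fin k → Bool) :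
    symz p (act g x) = symz p x := by
  unfold symz
  congr 1
  refine Fintype.sum_equiv
    ((Equiv.mulRight g.1).prodCongr (Equiv.mulLeft g.2)) _ _ fun h => ?_
  rfl

lemma symz_le {N k : ℕ} (p : (Fin N × Fin k → Bool) → ℝ) (x : Fin N × Fin k → Bool) (a : ℝ)
    (h : ∀ g, p (act g x) ≤ a) : symz p x ≤ a := by
  unfold symz
  rw [inv_mul_le_iff₀ (by exact_mod_cast Fintype.card_pos)]
  have := Finset.sum_le_card_nsmul Finset.univ _ a (fun g _ => h g)
  simpa using this

lemma le_symz {N k : ℕ} (p : (Fin N × Fin k → Bool) → ℝ) (x : Fin N × Fin k → Bool) (a : ℝ)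
    (h : ∀ g, a ≤ p (act g x)) : a ≤ symz p x := by
  unfold symz
  rw [le_inv_mul_iff₀ (by exact_mod_cast Fintype.card_pos)]
  have := Finset.card_nsmul_le_sum Finset.univ _ a (fun g _ => h g)
  simpa using this

lemma approx_of_oneSided (k d : ℕ) (ε : ℝ) (hε : 0 < ε)
    (c : Finset (Fin (2 ^ k) × Fin k) → ℝ) (hc : degLE c d)
    (h : IsOneSided (twoToOne k) (polyOf c) ε) :
    ∃ q, HasDeg (d * k) q ∧ IsApprox (twoToOne k) q ε := by
  obtain ⟨hF, hT⟩ := h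
  have hdeg : HasDeg (d * k) (symz (polyOf c)) :=
    (HasDeg.sum Finset.univ _ fun g _ => hasDeg_act g c hc).smul _
  have hF' : ∀ x, twoToOne k x = false → |symz (polyOf c) x - 1| ≤ ε := by
    intro x hx
    rw [abs_le]
    have h1 : ∀ g, -ε ≤ polyOf c (act g x) - 1 ∧ polyOf c (act g x) - 1 ≤ ε := fun g =>
      abs_le.1 (hF _ (by rw [twoToOne_act, hx]))
    have := symz_le (polyOf c) x (1 + ε) (fun g => by linarith [(h1 g).2])
    have := le_symz (polyOf c) x (1 - ε) (fun g => by linarith [(h1 g).1])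
    constructor <;> linarith
  have hT' : ∀ x, twoToOne k x = true → symz (polyOf c) x ≤ -1 + ε := fun x hx =>
    symz_le _ _ _ fun g => hT _ (by rw [twoToOne_act, hx])
  have hconst : ∀ x y, twoToOne k x = true → twoToOne k y = true →
      symz (polyOf c) x = symz (polyOf c) y := by
    intro x y hx hy
    obtain ⟨g, rfl⟩ := act_transitive k x y hx hy
    rw [symz_act]
  by_cases hbad : ∃ x0, twoToOne k x0 = true ∧ symz (polyOf c) x0 < -1 - ε
  · obtain ⟨x0, hx0, hlt⟩ := hbad
    set A := symz (polyOf c) x0 with hA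
    have hpos : 0 < 1 - A := by linarith
    refine ⟨fun x => (1 - 2 / (1 - A)) + 2 / (1 - A) * symz (polyOf c) x,
      (HasDeg.const _ _).add (hdeg.smul _), fun x => ?_⟩
    have ht0 : 0 ≤ 2 / (1 - A) := by positivity
    have ht1 : 2 / (1 - A) ≤ 1 := by rw [div_le_one hpos]; linarith
    cases hx : twoToOne k x
    · have : (1 - 2 / (1 - A)) + 2 / (1 - A) * symz (polyOf c) x - bval false =
          2 / (1 - A) * (symz (polyOf c) x - 1) := by simp [bval]; ring
      rw [this, abs_mul, abs_of_nonneg ht0]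
      exact (mul_le_of_le_one_left (abs_nonneg _) ht1).trans (hF' x hx)
    · beta_reduce
      rw [hconst x x0 hx hx0, ← hA]
      have : (1 - 2 / (1 - A)) + 2 / (1 - A) * A - bval true = 0 := by
        simp only [bval, if_true]
        field_simp
        ring
      rw [this, abs_zero]
      exact hε.le
  · push Not at hbad
    refine ⟨_, hdeg, fun x => ?_⟩
    cases hx : twoToOne k x
    · simpa [bval] using hF' x hx
    · have h1 := hbad x hx
      have h2 := hT' x hx
      simp only [bval, if_true]
      rw [abs_le]
      constructor <;> linarith

lemma oneSided_of_approx {ι : Type*} (f : (ι → Bool) → Bool) (p : (ι → Bool) → ℝ) (ε : ℝ)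
    (h : IsApprox f p ε) : IsOneSided f p ε := by
  refine ⟨fun x hx => ?_, fun x hx => ?_⟩
  · simpa [hx, bval] using h x
  · have := (abs_le.1 (h x)).2
    simp only [hx, bval, if_true] at this
    linarith

lemma adeg_le_mul (k : ℕ) (ε : ℝ) (hε : 0 < ε) :
    adeg ε (twoToOne k) ≤ odeg ε (twoToOne k) * k := by
  by_cases hne : {d | ∃ c, degLE c d ∧ IsOneSided (twoToOne k) (polyOf c) ε}.Nonempty
  · obtain ⟨c, hc, hone⟩ := Nat.sInf_mem hne
    obtain ⟨q, ⟨e, he, heq⟩, hq⟩ := approx_of_oneSided k _ ε hε c hc hone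
    refine Nat.sInf_le ⟨e, he, ?_⟩
    rwa [show polyOf e = q from funext heq]
  · have : {d | ∃ c, degLE c d ∧ IsApprox (twoToOne k) (polyOf c) ε} = ∅ := by
      rw [Set.eq_empty_iff_forall_notMem]
      rintro d ⟨c, hc, h⟩
      exact hne ⟨d, c, hc, oneSided_of_approx _ _ _ h⟩
    simp only [adeg, this, Nat.sInf_empty, Nat.zero_le]

/-- the one-sided `ε`-approximate degree of the 2-to-1 function on
`m = N·log₂N` variables (`N = 2^k` even, so `k ≥ 1`) is at least its `ε`-approximate
degree divided by `log₂ m`. -/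
theorem two_to_one_odeg (k : ℕ) (hk : 1 ≤ k) (ε : ℝ) (hε : 0 < ε) :
    (adeg ε (twoToOne k) : ℝ) / Real.logb 2 ((2 ^ k * k : ℕ) : ℝ)
      ≤ (odeg ε (twoToOne k) : ℝ) := by
  have hk1 : (1 : ℝ) ≤ k := by exact_mod_cast hk
  have hL : (k : ℝ) ≤ Real.logb 2 ((2 ^ k * k : ℕ) : ℝ) := by
    rw [Real.le_logb_iff_rpow_le (by norm_num) (by positivity)]
    push_cast
    rw [Real.rpow_natCast]
    exact le_mul_of_one_le_right (by positivity) hk1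
  rw [div_le_iff₀ (by linarith)]
  have h := adeg_le_mul k ε hε
  have h' : (adeg ε (twoToOne k) : ℝ) ≤ odeg ε (twoToOne k) * k := by exact_mod_cast h
  exact h'.trans (mul_le_mul_of_nonneg_left hL (Nat.cast_nonneg _))

end
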